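/- Let k ≥ 1 and let p : ℝ³ → ℝ³ be a vector field whose components are homogeneous polynomials of degree k. If x·p(x) = 0 for all x ∈ ℝ³ and the Kelvin transform p*(x) := |x|^{−(2k+1)} p(x) satisfies ∇×p* = 0 on ℝ³∖{0}, then p is identically zero. -/

import Mathlib

noncomputable section

open scoped BigOperators

/-- Points of `ℝ³`. -/
abbrev V3 : Type := Fin 3 → ℝ

/-- The Euclidean inner product on `ℝ³`. -/
def dot3 (x y : V3) : ℝ := ∑ i, x i * y i

/-- The Euclidean norm on `ℝ³`. -/
def norm3 (x : V3) : ℝ := Real.sqrt (dot3 x x)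

/-- The cross product on `ℝ³` (cyclic formula, `(x × y) i = x (i+1) y (i+2) - x (i+2) y (i+1)`). -/
def cross3 (x y : V3) : V3 := fun i => x (i + 1) * y (i + 2) - x (i + 2) * y (i + 1)

/-- Partial derivative in the `i`-th coordinate direction. -/
def pd (i : Fin 3) (f : V3 → ℝ) (x : V3) : ℝ := fderiv ℝ f x (Pi.single i 1)

/-- Gradient of a scalar field. -/
def grad3 (f : V3 → ℝ) (x : V3) : V3 := fun i => pd i f x

/-- Divergence of a vector field. -/
def div3 (p : V3 → V3) (x : V3) : ℝ := ∑ i, pd i (fun y => p y i) x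

/-- Curl of a vector field. -/
def curl3 (p : V3 → V3) (x : V3) : V3 :=
  fun i => pd (i + 1) (fun y => p y (i + 2)) x - pd (i + 2) (fun y => p y (i + 1)) x

/-- `f` is the function of a homogeneous polynomial of degree `k` on `ℝ³`. -/
def IsHomogPoly (k : ℕ) (f : V3 → ℝ) : Prop :=
  ∃ q : MvPolynomial (Fin 3) ℝ, q.IsHomogeneous k ∧ ∀ x, f x = MvPolynomial.eval x q

/-- `f` is harmonic (its Laplacian vanishes) on all of `ℝ³`. -/
def IsHarmonic (f : V3 → ℝ) : Prop := ∀ x, ∑ i, pd i (pd i f) x = 0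

/-- `P_k`: homogeneous harmonic polynomials of degree `k` (as functions on `ℝ³`). -/
def Pk (k : ℕ) : Set (V3 → ℝ) := {f | IsHomogPoly k f ∧ IsHarmonic f}

/-- `P_k³`: vector fields all of whose components lie in `P_k`. -/
def Pk3 (k : ℕ) : Set (V3 → V3) := {p | ∀ i, (fun x => p x i) ∈ Pk k}

/-- Kelvin transform of a degree-`k` homogeneous field: `p*(x) = |x|^{-(2k+1)} p(x)`. -/
def kelvin (k : ℕ) (p : V3 → V3) : V3 → V3 := fun x => (norm3 x ^ (2 * k + 1))⁻¹ • p x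

/-- `W_k^o`: fields in `P_k³` that are divergence free on `ℝ³` and whose Kelvin transform
is divergence free on `ℝ³ \ {0}`. -/
def Wko (k : ℕ) : Set (V3 → V3) :=
  {p | p ∈ Pk3 k ∧ (∀ x, div3 p x = 0) ∧ ∀ x : V3, x ≠ 0 → div3 (kelvin k p) x = 0}

/-- `W_k^-`: fields in `P_k³` that are divergence free and curl free on `ℝ³`. -/
def Wkm (k : ℕ) : Set (V3 → V3) :=
  {p | p ∈ Pk3 k ∧ (∀ x, div3 p x = 0) ∧ ∀ x, curl3 p x = 0}

/-- `W_k^+`: fields in `P_k³` whose Kelvin transform is divergence free and curl free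
on `ℝ³ \ {0}`. -/
def Wkp (k : ℕ) : Set (V3 → V3) :=
  {p | p ∈ Pk3 k ∧ (∀ x : V3, x ≠ 0 → div3 (kelvin k p) x = 0) ∧
    ∀ x : V3, x ≠ 0 → curl3 (kelvin k p) x = 0}

theorem MvPolynomial.IsHomogeneous.eval_smul_pow {σ R : Type*} [Fintype σ] [CommRing R] {n : ℕ}
    {q : MvPolynomial σ R} (hq : q.IsHomogeneous n) (t : R) (x : σ → R) :
    MvPolynomial.eval (t • x) q = t ^ n * MvPolynomial.eval x q := by
  rw [MvPolynomial.eval_eq', MvPolynomial.eval_eq', Finset.mul_sum]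
  refine Finset.sum_congr rfl fun d hd => ?_
  have hdeg : ∑ i, d i = n := by
    have h := hq (MvPolynomial.mem_support_iff.mp hd)
    rw [← Finsupp.degree_eq_sum, ← h]
    exact DFunLike.congr_fun Finsupp.degree_eq_weight_one d
  simp only [Pi.smul_apply, smul_eq_mul, mul_pow, Finset.prod_mul_distrib,
    Finset.prod_pow_eq_pow_sum, hdeg]
  ring

theorem IsHomogPoly.apply_smul {k : ℕ} {f : V3 → ℝ} (hf : IsHomogPoly k f) (t : ℝ) (x : V3) :
    f (t • x) = t ^ k * f x := by
  obtain ⟨q, hq, hfq⟩ := hf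
  rw [hfq, hfq, hq.eval_smul_pow]

theorem IsHomogPoly.differentiable {k : ℕ} {f : V3 → ℝ} (hf : IsHomogPoly k f) :
    Differentiable ℝ f := by
  obtain ⟨q, -, hfq⟩ := hf
  rw [funext hfq]
  exact fun x => (AnalyticOnNhd.eval_mvPolynomial q x (Set.mem_univ x)).differentiableAt

theorem dot3_self_pos {x : V3} (hx : x ≠ 0) : 0 < dot3 x x := by
  obtain ⟨i, hi⟩ := Function.ne_iff.mp hx
  exact Finset.sum_pos' (fun j _ => mul_self_nonneg (x j))
    ⟨i, Finset.mem_univ i, mul_self_pos.mpr hi⟩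

theorem norm3_smul {t : ℝ} (ht : 0 ≤ t) (x : V3) : norm3 (t • x) = t * norm3 x := by
  have h : dot3 (t • x) (t • x) = t ^ 2 * dot3 x x := by
    simp only [dot3, Finset.mul_sum, Pi.smul_apply, smul_eq_mul]
    exact Finset.sum_congr rfl fun i _ => by ring
  rw [norm3, norm3, h, Real.sqrt_mul (sq_nonneg t), Real.sqrt_sq ht]

theorem differentiableAt_norm3 {x : V3} (hx : x ≠ 0) : DifferentiableAt ℝ norm3 x := by
  have h : DifferentiableAt ℝ (fun y : V3 => dot3 y y) x := by
    unfold dot3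
    fun_prop
  exact h.sqrt (dot3_self_pos hx).ne'

theorem norm3_ne_zero {x : V3} (hx : x ≠ 0) : norm3 x ≠ 0 :=
  (Real.sqrt_pos.mpr (dot3_self_pos hx)).ne'

theorem differentiableAt_kelvin {k : ℕ} {p : V3 → V3} (hp : ∀ i, IsHomogPoly k (fun x => p x i))
    {x : V3} (hx : x ≠ 0) (i : Fin 3) : DifferentiableAt ℝ (fun y => kelvin k p y i) x := by
  have h := ((differentiableAt_norm3 hx).fun_pow (2 * k + 1)).fun_inv
    (pow_ne_zero _ (norm3_ne_zero hx))
  exact h.fun_mul ((hp i).differentiable x)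

theorem kelvin_smul {k : ℕ} {p : V3 → V3} (hp : ∀ i, IsHomogPoly k (fun x => p x i))
    {t : ℝ} (ht : 0 < t) (x : V3) (i : Fin 3) :
    kelvin k p (t • x) i = (t ^ (k + 1))⁻¹ * kelvin k p x i := by
  have h := (hp i).apply_smul t x
  simp only [kelvin, Pi.smul_apply, smul_eq_mul, norm3_smul ht.le, h, mul_pow, mul_inv]
  field_simp
  ring

theorem fderiv_apply_eq_sum_pd (f : V3 → ℝ) (x v : V3) :
    fderiv ℝ f x v = ∑ i, v i * pd i f x := by
  have hv : v = ∑ i, v i • Pi.single i (1 : ℝ) := by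
    ext j
    simp [Finset.sum_apply, Pi.single_apply]
  conv_lhs => rw [hv]
  simp only [map_sum, map_smul, smul_eq_mul, pd]

/-- Euler's identity for the Kelvin transform, which is homogeneous of degree `-(k + 1)`. -/
theorem sum_mul_pd_kelvin {k : ℕ} {p : V3 → V3} (hp : ∀ i, IsHomogPoly k (fun x => p x i))
    {x : V3} (hx : x ≠ 0) (j : Fin 3) :
    ∑ i, x i * pd i (fun y => kelvin k p y j) x = -(k + 1 : ℝ) * kelvin k p x j := by
  rw [← fderiv_apply_eq_sum_pd]
  have hline : HasDerivAt (fun t : ℝ => t • x) x 1 := by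
    simpa using (hasDerivAt_id (1 : ℝ)).smul_const x
  have hd : HasFDerivAt (fun y => kelvin k p y j) (fderiv ℝ (fun y => kelvin k p y j) x)
      ((1 : ℝ) • x) := by
    rw [one_smul]
    exact (differentiableAt_kelvin hp hx j).hasFDerivAt
  have h₁ := hd.comp_hasDerivAt (1 : ℝ) hline
  have h₂ : HasDerivAt (fun t : ℝ => (t ^ (k + 1))⁻¹ * kelvin k p x j)
      (-(k + 1 : ℝ) * kelvin k p x j) 1 := by
    simpa using ((hasDerivAt_pow (k + 1) (1 : ℝ)).fun_inv (by simp)).mul_const (kelvin k p x j)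
  refine h₁.unique (h₂.congr_of_eventuallyEq ?_)
  filter_upwards [lt_mem_nhds (zero_lt_one' ℝ)] with t ht
  exact kelvin_smul hp ht x j

/-- A curl-free field has a symmetric Jacobian matrix. -/
theorem pd_comm_of_curl3_eq_zero {u : V3 → V3} {x : V3} (h : curl3 u x = 0) (i j : Fin 3) :
    pd i (fun y => u y j) x = pd j (fun y => u y i) x := by
  have h0 := congrFun h 0
  have h1 := congrFun h 1
  have h2 := congrFun h 2
  simp only [curl3, Pi.zero_apply, Fin.reduceAdd, sub_eq_zero] at h0 h1 h2
  fin_cases i <;> fin_cases j <;> first | rfl | assumption | (symm; assumption)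

/-- Differentiating the identity `y · u(y) = 0` in the direction `e_j`. -/
theorem sum_mul_pd_of_dot3_eq_zero {u : V3 → V3} {x : V3} (hu : ∀ y, dot3 y (u y) = 0)
    (hd : ∀ i, DifferentiableAt ℝ (fun y => u y i) x) (j : Fin 3) :
    ∑ i, x i * pd j (fun y => u y i) x = -u x j := by
  have h : HasFDerivAt (fun y => dot3 y (u y)) _ x :=
    HasFDerivAt.fun_sum fun i (_ : i ∈ Finset.univ) =>
      (hasFDerivAt_apply (𝕜 := ℝ) i x).fun_mul (hd i).hasFDerivAt
  have h0 : HasFDerivAt (fun y => dot3 y (u y)) (0 : V3 →L[ℝ] ℝ) x := by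
    rw [funext hu]
    exact hasFDerivAt_const 0 x
  have := congrArg (fun L : V3 →L[ℝ] ℝ => L (Pi.single j 1)) (h.unique h0)
  simp only [sum_apply, add_apply,
    smul_apply, ContinuousLinearMap.proj_apply, smul_eq_mul,
    zero_apply, Finset.sum_add_distrib, Pi.single_apply, mul_ite, mul_one,
    mul_zero, Finset.sum_ite_eq', Finset.mem_univ, if_true] at this
  exact eq_neg_of_add_eq_zero_left this

/-- If `k ≥ 1`, `p` has homogeneous polynomial components of degree `k`,
`x·p(x) = 0` on `ℝ³`, and `∇×p* = 0` on `ℝ³ \ {0}`, then `p` is identically zero. -/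
theorem tangential_kelvin_curl_free_zero (k : ℕ) (hk : 1 ≤ k) (p : V3 → V3)
    (hp : ∀ i, IsHomogPoly k (fun x => p x i))
    (htan : ∀ x, dot3 x (p x) = 0)
    (hcurl : ∀ x : V3, x ≠ 0 → curl3 (kelvin k p) x = 0) :
    ∀ x, p x = 0 := by
  intro x
  ext j
  rcases eq_or_ne x 0 with rfl | hx
  · simpa [Nat.one_le_iff_ne_zero.mp hk] using (hp j).apply_smul 0 0
  have htan' : ∀ y, dot3 y (kelvin k p y) = 0 := fun y => by
    have h : dot3 y (kelvin k p y) = (norm3 y ^ (2 * k + 1))⁻¹ * dot3 y (p y) := by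
      simp only [dot3, kelvin, Finset.mul_sum, Pi.smul_apply, smul_eq_mul]
      exact Finset.sum_congr rfl fun i _ => by ring
    rw [h, htan, mul_zero]
  have hradial := sum_mul_pd_of_dot3_eq_zero htan' (differentiableAt_kelvin hp hx) j
  have heuler := sum_mul_pd_kelvin hp hx j
  simp only [pd_comm_of_curl3_eq_zero (hcurl x hx) _ j, hradial] at heuler
  have hzero : (k : ℝ) * kelvin k p x j = 0 := by linarith
  have hk' : (k : ℝ) ≠ 0 := Nat.cast_ne_zero.mpr (Nat.one_le_iff_ne_zero.mp hk)
  exact (mul_eq_zero.mp ((mul_eq_zero.mp hzero).resolve_left hk')).resolve_left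
    (inv_ne_zero (pow_ne_zero _ (norm3_ne_zero hx)))
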